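/- Concavity of the Renyi divergence for cold thermal resources: Let n ≥ 1, E : Fin n → ℝ, and β ≤ β_R be reals. If the thermal energy function t ↦ Eav t is convex on the interval Set.Icc β β_R, then the function α ↦ (α − 1)⁻¹ · Real.log (Σ_i (ω β_R i)^α · (ω β i)^(1−α)) is concave on Set.Ico (0 : ℝ) 1. -/

import Mathlib

/-- Partition function of energies `E` at inverse temperature `t`. -/
noncomputable def Zf {n : ℕ} (E : Fin n → ℝ) (t : ℝ) : ℝ := ∑ i, Real.exp (-t * E i)

/-- Gibbs distribution of energies `E` at inverse temperature `t`. -/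
noncomputable def gibbs {n : ℕ} (E : Fin n → ℝ) (t : ℝ) (i : Fin n) : ℝ :=
  Real.exp (-t * E i) / Zf E t

/-- Thermal average energy. -/
noncomputable def Eav {n : ℕ} (E : Fin n → ℝ) (t : ℝ) : ℝ := ∑ i, E i * gibbs E t i

lemma Zf_pos {n : ℕ} (hn : 1 ≤ n) (E : Fin n → ℝ) (t : ℝ) : 0 < Zf E t :=
  Finset.sum_pos (fun _ _ => Real.exp_pos _) ⟨⟨0, hn⟩, Finset.mem_univ _⟩

lemma hasDerivAt_Zf {n : ℕ} (E : Fin n → ℝ) (t : ℝ) :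
    HasDerivAt (Zf E) (-∑ i, E i * Real.exp (-t * E i)) t := by
  have hsum : HasDerivAt (fun t => ∑ i, Real.exp (-t * E i))
      (∑ i, Real.exp (-t * E i) * (-1 * E i)) t :=
    HasDerivAt.fun_sum fun i _ => (((hasDerivAt_id t).neg).mul_const (E i)).exp
  refine hsum.congr_deriv ?_
  rw [← Finset.sum_neg_distrib]
  exact Finset.sum_congr rfl fun i _ => by ring

lemma hasDerivAt_log_Zf {n : ℕ} (hn : 1 ≤ n) (E : Fin n → ℝ) (t : ℝ) :
    HasDerivAt (fun t => Real.log (Zf E t)) (-Eav E t) t := by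
  convert (hasDerivAt_Zf E t).log (Zf_pos hn E t).ne' using 1
  simp only [Eav, gibbs, neg_div, Finset.sum_div, mul_div_assoc]

lemma continuous_Eav {n : ℕ} (hn : 1 ≤ n) (E : Fin n → ℝ) : Continuous (Eav E) := by
  have hZ : Continuous (Zf E) :=
    continuous_iff_continuousAt.2 fun t => (hasDerivAt_Zf E t).continuousAt
  unfold Eav gibbs
  exact continuous_finsetSum _ fun i _ => continuous_const.mul
    ((by fun_prop : Continuous fun t : ℝ => Real.exp (-t * E i)).div hZ
      fun t => (Zf_pos hn E t).ne')

lemma log_sum_gibbs_rpow {n : ℕ} (hn : 1 ≤ n) (E : Fin n → ℝ) (s t α : ℝ) :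
    Real.log (∑ i, gibbs E s i ^ α * gibbs E t i ^ (1 - α)) =
      Real.log (Zf E (t + (s - t) * α)) - α * Real.log (Zf E s)
        - (1 - α) * Real.log (Zf E t) := by
  have hs := Zf_pos hn E s
  have ht := Zf_pos hn E t
  have hsum : ∑ i, gibbs E s i ^ α * gibbs E t i ^ (1 - α) =
      Zf E (t + (s - t) * α) / (Zf E s ^ α * Zf E t ^ (1 - α)) := by
    conv_rhs => rw [Zf, Finset.sum_div]
    refine Finset.sum_congr rfl fun i _ => ?_
    rw [gibbs, gibbs, Real.div_rpow (Real.exp_pos _).le hs.le,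
      Real.div_rpow (Real.exp_pos _).le ht.le, ← Real.exp_mul, ← Real.exp_mul,
      div_mul_div_comm, ← Real.exp_add]
    congr 2
    ring
  rw [hsum, Real.log_div (Zf_pos hn E _).ne' (by positivity),
    Real.log_mul (by positivity) (by positivity), Real.log_rpow hs, Real.log_rpow ht]
  ring

/-- The Renyi divergence of two Gibbs distributions as an average of thermal energies. -/
lemma renyi_gibbs_eq_integral {n : ℕ} (hn : 1 ≤ n) (E : Fin n → ℝ) (s t : ℝ) {α : ℝ}
    (hα : α < 1) :
    (α - 1)⁻¹ * Real.log (∑ i, gibbs E s i ^ α * gibbs E t i ^ (1 - α)) =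
      Real.log (Zf E t) - Real.log (Zf E s) -
        (s - t) * ∫ u in (0:ℝ)..1, Eav E (t + (s - t) * (α + u * (1 - α))) := by
  have hderiv : ∀ u ∈ Set.uIcc (0:ℝ) 1, HasDerivAt
      (fun u : ℝ => Real.log (Zf E (t + (s - t) * (α + u * (1 - α)))))
      (-((s - t) * (1 - α)) * Eav E (t + (s - t) * (α + u * (1 - α)))) u := by
    intro u _
    have hin : HasDerivAt (fun u : ℝ => t + (s - t) * (α + u * (1 - α)))
        ((s - t) * (1 * (1 - α))) u :=
      ((((hasDerivAt_id u).mul_const (1 - α)).const_add α).const_mul (s - t)).const_add t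
    exact ((hasDerivAt_log_Zf hn E _).comp u hin).congr_deriv (by ring)
  have hcont : Continuous fun u : ℝ => Eav E (t + (s - t) * (α + u * (1 - α))) :=
    (continuous_Eav hn E).comp (by fun_prop)
  have hint := intervalIntegral.integral_eq_sub_of_hasDerivAt hderiv
    ((continuous_const.mul hcont).intervalIntegrable 0 1)
  have hend : t + (s - t) * (α + 1 * (1 - α)) = s := by ring
  rw [intervalIntegral.integral_const_mul, hend, zero_mul, add_zero] at hint
  rw [log_sum_gibbs_rpow hn]
  have hα' : α - 1 ≠ 0 := by linarith
  rw [inv_mul_eq_iff_eq_mul₀ hα']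
  linear_combination hint

theorem renyi_concave_cold_resource (n : ℕ) (hn : 1 ≤ n) (E : Fin n → ℝ)
    (β βR : ℝ) (h : β ≤ βR)
    (hconv : ConvexOn ℝ (Set.Icc β βR) (fun t => Eav E t)) :
    ConcaveOn ℝ (Set.Ico (0:ℝ) 1)
      (fun α : ℝ =>
        (α - 1)⁻¹ * Real.log (∑ i, gibbs E βR i ^ α * gibbs E β i ^ (1 - α))) := by
  refine ⟨convex_Ico 0 1, fun x hx y hy a b ha hb hab => ?_⟩
  have hxy := convex_Ico (0:ℝ) 1 hx hy ha hb hab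
  beta_reduce
  rw [renyi_gibbs_eq_integral hn E _ _ hx.2, renyi_gibbs_eq_integral hn E _ _ hy.2,
    renyi_gibbs_eq_integral hn E _ _ hxy.2]
  have hint : ∀ α : ℝ, IntervalIntegrable
      (fun u : ℝ => Eav E (β + (βR - β) * (α + u * (1 - α)))) MeasureTheory.volume 0 1 :=
    fun α => ((continuous_Eav hn E).comp (by fun_prop)).intervalIntegrable 0 1
  have hmem : ∀ {α u : ℝ}, α ∈ Set.Ico (0:ℝ) 1 → u ∈ Set.Icc (0:ℝ) 1 →
      β + (βR - β) * (α + u * (1 - α)) ∈ Set.Icc β βR := by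
    intro α u hα hu
    have h1 : 0 ≤ α + u * (1 - α) := by nlinarith [hα.1, hα.2, hu.1]
    have h2 : α + u * (1 - α) ≤ 1 := by nlinarith [hα.2, hu.2]
    constructor <;> nlinarith
  have hmono : ∫ u in (0:ℝ)..1, Eav E (β + (βR - β) *
        ((a • x + b • y) + u * (1 - (a • x + b • y)))) ≤
      ∫ u in (0:ℝ)..1, (a * Eav E (β + (βR - β) * (x + u * (1 - x))) +
        b * Eav E (β + (βR - β) * (y + u * (1 - y)))) := by
    refine intervalIntegral.integral_mono_on zero_le_one (hint _)
      (((hint x).const_mul a).add ((hint y).const_mul b)) fun u hu => ?_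
    have harg : β + (βR - β) * ((a • x + b • y) + u * (1 - (a • x + b • y))) =
        a • (β + (βR - β) * (x + u * (1 - x))) + b • (β + (βR - β) * (y + u * (1 - y))) := by
      simp only [smul_eq_mul]
      linear_combination (-β - (βR - β) * u) * hab
    rw [harg]
    exact hconv.2 (hmem hx hu) (hmem hy hu) ha hb hab
  rw [intervalIntegral.integral_add ((hint x).const_mul a) ((hint y).const_mul b),
    intervalIntegral.integral_const_mul, intervalIntegral.integral_const_mul] at hmono
  have hscaled := mul_le_mul_of_nonneg_left hmono (sub_nonneg.2 h)
  obtain rfl : b = 1 - a := by linarith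
  simp only [smul_eq_mul] at hscaled ⊢
  linarith
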